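/- For every nonzero element U of H(q) there exist a finite composition ψ of maps from Φ_ℤ, a nonzero scalar a ∈ ℂ, and a positive integer N such that ψ(U) = a·C^N. -/

import Mathlib

noncomputable section

/-- Generators of the `q`-deformed Heisenberg algebra. -/
inductive HGen : Type
  | A : HGen
  | B : HGen

/-- The defining relation `AB = q • BA + 1` of the `q`-deformed Heisenberg algebra. -/
inductive HRel (q : ℂ) : FreeAlgebra ℂ HGen → FreeAlgebra ℂ HGen → Prop
  | rel : HRel q (FreeAlgebra.ι ℂ HGen.A * FreeAlgebra.ι ℂ HGen.B)
      (q • (FreeAlgebra.ι ℂ HGen.B * FreeAlgebra.ι ℂ HGen.A) + 1)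

/-- The `q`-deformed Heisenberg algebra `H(q)`, presented by generators `A`, `B`
and the single relation `AB - q • BA = 1`. -/
abbrev HAlg (q : ℂ) := RingQuot (HRel q)

/-- The generator `A` of `H(q)`. -/
def genA (q : ℂ) : HAlg q := RingQuot.mkAlgHom ℂ (HRel q) (FreeAlgebra.ι ℂ HGen.A)

/-- The generator `B` of `H(q)`. -/
def genB (q : ℂ) : HAlg q := RingQuot.mkAlgHom ℂ (HRel q) (FreeAlgebra.ι ℂ HGen.B)

/-- The element `C = AB - BA` of `H(q)`. -/
def genC (q : ℂ) : HAlg q := genA q * genB q - genB q * genA q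

/-- The deformed commutator map `θ_n : γ ↦ Aγ - q^n γA` on `H(q)`, `n ∈ ℤ`. -/
def thetaZ (q : ℂ) (n : ℤ) (x : HAlg q) : HAlg q :=
  genA q * x - q ^ n • (x * genA q)

/-- The deformed commutator map `η_n : γ ↦ Bγ - q^n γB` on `H(q)`, `n ∈ ℤ`. -/
def etaZ (q : ℂ) (n : ℤ) (x : HAlg q) : HAlg q :=
  genB q * x - q ^ n • (x * genB q)

/-- The graded component `H_i` of `H(q)`: for `i < 0` the span of `{C^k A^(-i) : k ∈ ℕ}`,
for `i > 0` the span of `{C^k B^i : k ∈ ℕ}`, and for `i = 0` the span of `{C^k : k ∈ ℕ}`. -/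
def Hgr (q : ℂ) (i : ℤ) : Submodule ℂ (HAlg q) :=
  Submodule.span ℂ {x | ∃ k : ℕ,
    x = genC q ^ k * (if i < 0 then genA q ^ (-i).toNat else genB q ^ i.toNat)}

/-- The collection `Φ_ℤ = {θ_n : n ∈ ℤ} ∪ {η_n : n ∈ ℤ}` of deformed commutator maps. -/
def PhiZ (q : ℂ) : Set (HAlg q → HAlg q) :=
  {f | ∃ n : ℤ, f = thetaZ q n ∨ f = etaZ q n}

section Relations

variable {q : ℂ}

lemma genA_mul_genB (q : ℂ) : genA q * genB q = q • (genB q * genA q) + 1 := by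
  have h := RingQuot.mkAlgHom_rel ℂ (HRel.rel (q := q))
  simpa [genA, genB] using h

lemma HAlg.sub_smul (a b : ℂ) (x : HAlg q) : (a - b) • x = a • x - b • x :=
  _root_.sub_smul a b x

lemma genC_eq (q : ℂ) : genC q = (q - 1) • (genB q * genA q) + 1 := by
  rw [genC, genA_mul_genB, HAlg.sub_smul, one_smul]
  abel

lemma genB_mul_genA (hq : q - 1 ≠ 0) :
    genB q * genA q = (q - 1)⁻¹ • (genC q - 1) := by
  rw [genC_eq, add_sub_cancel_right, inv_smul_smul₀ hq]

lemma genA_mul_genB' (hq : q - 1 ≠ 0) :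
    genA q * genB q = (q - 1)⁻¹ • (q • genC q - 1) := by
  rw [eq_inv_smul_iff₀ hq, genC_eq, genA_mul_genB]
  module

lemma genA_mul_genC (q : ℂ) : genA q * genC q = q • genC q * genA q := by
  have h : genA q * genB q * genA q = q • (genB q * genA q * genA q) + genA q := by
    rw [genA_mul_genB, add_mul, smul_mul_assoc, one_mul]
  rw [genC_eq, mul_add, mul_smul_comm, ← mul_assoc, h, smul_mul_assoc, add_mul, smul_mul_assoc]
  simp only [mul_one, one_mul]
  module

lemma genB_mul_genC (hq0 : q ≠ 0) : genB q * genC q = q⁻¹ • genC q * genB q := by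
  rw [smul_mul_assoc, eq_inv_smul_iff₀ hq0]
  have h : genB q * genA q * genB q = q • (genB q * genB q * genA q) + genB q := by
    rw [mul_assoc, genA_mul_genB, mul_add, mul_smul_comm, mul_one, mul_assoc]
  rw [genC_eq, add_mul, smul_mul_assoc, h, mul_add, mul_smul_comm, ← mul_assoc]
  simp only [mul_one, one_mul]
  module

end Relations

section SkewCommutation

open Polynomial

variable {R : Type*} [Ring R] [Algebra ℂ R] {x c : R} {t : ℂ}

lemma pow_mul_of_skew (h : x * c = t • c * x) (m : ℕ) : x ^ m * c = t ^ m • c * x ^ m := by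
  induction m with
  | zero => simp
  | succ m ih =>
    rw [pow_succ, mul_assoc, h, smul_mul_assoc, mul_smul_comm, ← mul_assoc, ih]
    simp only [smul_mul_assoc, mul_assoc, smul_smul, pow_succ]
    rw [mul_comm t]

lemma mul_pow_of_skew (h : x * c = t • c * x) (k : ℕ) : x * c ^ k = t ^ k • (c ^ k * x) := by
  induction k with
  | zero => simp
  | succ k ih =>
    rw [pow_succ, ← mul_assoc, ih, smul_mul_assoc, mul_assoc, h]
    simp only [smul_mul_assoc, mul_smul_comm, smul_smul, mul_assoc, pow_succ]

lemma mul_aeval_of_skew (h : x * c = t • c * x) (r : ℂ[X]) :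
    x * aeval c r = aeval c (r.comp (C t * X)) * x := by
  induction r using Polynomial.induction_on' with
  | add p s hp hs => simp only [map_add, add_comp, mul_add, add_mul, hp, hs]
  | monomial k a =>
    simp only [← C_mul_X_pow_eq_monomial, mul_comp, C_comp, X_pow_comp, mul_pow, map_mul, map_pow,
      aeval_C, aeval_X, Algebra.algebraMap_eq_smul_one, smul_mul_assoc, one_mul, mul_smul_comm,
      mul_pow_of_skew h, _root_.smul_pow, one_pow]
    rw [smul_comm]

end SkewCommutation

section NormalForm

open Polynomial

variable {q : ℂ}

/-- The homogeneous generator of index `i`: `A ^ i` for `0 ≤ i` and `B ^ (-i)` for `i < 0`. -/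
def gradedGen (q : ℂ) : ℤ → HAlg q
  | Int.ofNat n => genA q ^ n
  | Int.negSucc n => genB q ^ (n + 1)

lemma gradedGen_natCast (n : ℕ) : gradedGen q n = genA q ^ n := rfl

lemma gradedGen_negSucc (n : ℕ) : gradedGen q (Int.negSucc n) = genB q ^ (n + 1) := rfl

lemma gradedGen_negSucc_add_one (n : ℕ) : gradedGen q (Int.negSucc n + 1) = genB q ^ n := by
  cases n with
  | zero => exact (pow_zero (genA q)).trans (pow_zero (genB q)).symm
  | succ n =>
    rw [← gradedGen_negSucc]
    congr 1

lemma gradedGen_natCast_add_one (n : ℕ) : gradedGen q ((n : ℤ) + 1) = genA q ^ (n + 1) := by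
  rw [← gradedGen_natCast]
  congr 1

lemma exists_genA_mul_gradedGen (hq : q - 1 ≠ 0) (i : ℤ) :
    ∃ s : ℂ[X], genA q * gradedGen q i = aeval (genC q) s * gradedGen q (i + 1) := by
  rcases i with n | n
  · refine ⟨1, ?_⟩
    simp only [Int.ofNat_eq_natCast, gradedGen_natCast_add_one, gradedGen_natCast, pow_succ']
    simp
  · refine ⟨C (q - 1)⁻¹ * (C q * X - 1), ?_⟩
    rw [gradedGen_negSucc_add_one, gradedGen_negSucc, pow_succ', ← mul_assoc, genA_mul_genB' hq]
    simp [Algebra.smul_def]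

lemma exists_genB_mul_gradedGen (hq : q - 1 ≠ 0) (i : ℤ) :
    ∃ s : ℂ[X], genB q * gradedGen q i = aeval (genC q) s * gradedGen q (i - 1) := by
  obtain ⟨j, rfl⟩ : ∃ j, i = j + 1 := ⟨i - 1, by ring⟩
  rw [add_sub_cancel_right]
  rcases j with n | n
  · refine ⟨C (q - 1)⁻¹ * (X - 1), ?_⟩
    simp only [Int.ofNat_eq_natCast, gradedGen_natCast_add_one, gradedGen_natCast]
    rw [pow_succ', ← mul_assoc, genB_mul_genA hq]
    simp [Algebra.smul_def]
  · refine ⟨1, ?_⟩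
    rw [gradedGen_negSucc_add_one, gradedGen_negSucc, pow_succ']
    simp

/-- The linear map `r ↦ r(C) * gradedGen i`. -/
def gradedMap (q : ℂ) (i : ℤ) : ℂ[X] →ₗ[ℂ] HAlg q :=
  LinearMap.mulRight ℂ (gradedGen q i) ∘ₗ (aeval (genC q)).toLinearMap

lemma gradedMap_apply (i : ℤ) (r : ℂ[X]) :
    gradedMap q i r = aeval (genC q) r * gradedGen q i := rfl

lemma mul_mem_iSup_range_gradedMap {x : HAlg q} {t : ℂ} (hx : x * genC q = t • genC q * x)
    {e : ℤ} (h : ∀ i, ∃ s : ℂ[X], x * gradedGen q i = aeval (genC q) s * gradedGen q (i + e))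
    {y : HAlg q} (hy : y ∈ ⨆ i, LinearMap.range (gradedMap q i)) :
    x * y ∈ ⨆ i, LinearMap.range (gradedMap q i) := by
  have key : (⨆ i, LinearMap.range (gradedMap q i)) ≤
      (⨆ i, LinearMap.range (gradedMap q i)).comap (LinearMap.mulLeft ℂ x) := by
    refine iSup_le fun i => ?_
    rintro _ ⟨r, rfl⟩
    obtain ⟨s, hs⟩ := h i
    refine Submodule.mem_iSup_of_mem (i + e) ⟨r.comp (C t * X) * s, ?_⟩
    rw [LinearMap.mulLeft_apply, gradedMap_apply, gradedMap_apply, ← mul_assoc,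
      mul_aeval_of_skew hx, mul_assoc, hs, map_mul, mul_assoc]
  exact key hy

lemma iSup_range_gradedMap (hq0 : q ≠ 0) (hq : q - 1 ≠ 0) :
    (⨆ i, LinearMap.range (gradedMap q i)) = ⊤ := by
  refine Submodule.eq_top_iff'.2 fun U => ?_
  obtain ⟨u, rfl⟩ := RingQuot.mkAlgHom_surjective ℂ (HRel q) U
  have key : ∀ y ∈ ⨆ i, LinearMap.range (gradedMap q i),
      RingQuot.mkAlgHom ℂ (HRel q) u * y ∈ ⨆ i, LinearMap.range (gradedMap q i) := by
    induction u using FreeAlgebra.induction with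
    | grade0 a =>
      intro y hy
      rw [AlgHom.commutes, ← Algebra.smul_def]
      exact Submodule.smul_mem _ _ hy
    | grade1 g =>
      intro y hy
      cases g with
      | A => exact mul_mem_iSup_range_gradedMap (genA_mul_genC q) (exists_genA_mul_gradedGen hq) hy
      | B =>
        exact mul_mem_iSup_range_gradedMap (genB_mul_genC hq0) (exists_genB_mul_gradedGen hq) hy
    | mul a b ha hb =>
      intro y hy
      rw [map_mul, mul_assoc]
      exact ha _ (hb _ hy)
    | add a b ha hb =>
      intro y hy
      rw [map_add, add_mul]
      exact Submodule.add_mem _ (ha _ hy) (hb _ hy)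
  have h1 : (1 : HAlg q) ∈ ⨆ i, LinearMap.range (gradedMap q i) :=
    Submodule.mem_iSup_of_mem 0 ⟨1, by
      rw [gradedMap_apply, map_one, one_mul]; exact pow_zero _⟩
  simpa using key 1 h1

lemma exists_eq_sum_gradedGen (hq0 : q ≠ 0) (hq : q - 1 ≠ 0) (U : HAlg q) :
    ∃ (s : Finset ℤ) (p : ℤ → ℂ[X]), U = ∑ i ∈ s, aeval (genC q) (p i) * gradedGen q i := by
  have hU : U ∈ ⨆ i, LinearMap.range (gradedMap q i) := by
    rw [iSup_range_gradedMap hq0 hq]; trivial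
  obtain ⟨f, hf, rfl⟩ := (Submodule.mem_iSup_iff_exists_finsupp _ _).1 hU
  choose p hp using hf
  exact ⟨f.support, p, Finset.sum_congr rfl fun i _ => (hp i).symm⟩

end NormalForm

section DeformedCommutators

open Polynomial

variable {q : ℂ}

lemma thetaZ_sum {ι : Type*} (n : ℤ) (s : Finset ι) (f : ι → HAlg q) :
    thetaZ q n (∑ i ∈ s, f i) = ∑ i ∈ s, thetaZ q n (f i) := by
  simp [thetaZ, Finset.mul_sum, Finset.sum_mul, Finset.smul_sum, Finset.sum_sub_distrib]

lemma thetaZ_add (n : ℤ) (x y : HAlg q) :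
    thetaZ q n (x + y) = thetaZ q n x + thetaZ q n y := by
  simp only [thetaZ, mul_add, add_mul, smul_add]
  abel

lemma etaZ_sum {ι : Type*} (n : ℤ) (s : Finset ι) (f : ι → HAlg q) :
    etaZ q n (∑ i ∈ s, f i) = ∑ i ∈ s, etaZ q n (f i) := by
  simp [etaZ, Finset.mul_sum, Finset.sum_mul, Finset.smul_sum, Finset.sum_sub_distrib]

lemma etaZ_smul (n : ℤ) (a : ℂ) (x : HAlg q) : etaZ q n (a • x) = a • etaZ q n x := by
  simp only [etaZ, mul_smul_comm, smul_mul_assoc, smul_sub, smul_comm a]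

lemma pow_ne_pow_of_not_root (hq0 : q ≠ 0) (hq1 : ∀ m : ℕ, 0 < m → q ^ m ≠ 1) {m n : ℕ}
    (h : m ≠ n) : q ^ m ≠ q ^ n := by
  wlog hlt : m < n generalizing m n
  · exact (this h.symm (by omega)).symm
  intro he
  obtain ⟨d, rfl⟩ := Nat.exists_eq_add_of_lt hlt
  refine hq1 (d + 1) (by omega) (mul_left_cancel₀ (pow_ne_zero m hq0) ?_)
  rw [← pow_add, mul_one, he, add_assoc]

/-- `θ_{-1}` sends a nonzero homogeneous element to a nonzero homogeneous one (in coordinates). -/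
lemma thetaZ_neg_one_gradedGen (hq0 : q ≠ 0) (hq1 : ∀ m : ℕ, 0 < m → q ^ m ≠ 1) (i : ℤ)
    (r : ℂ[X]) : ∃ r' : ℂ[X], (r ≠ 0 → r' ≠ 0) ∧
      thetaZ q (-1) (aeval (genC q) r * gradedGen q i) =
        aeval (genC q) r' * gradedGen q (i + 1) := by
  have hq : q - 1 ≠ 0 := sub_ne_zero.2 (by simpa using hq1 1 one_pos)
  rcases i with n | n
  · refine ⟨r.comp (C q * X) - C q⁻¹ * r, fun hr h0 => ?_, ?_⟩
    · have h := congrArg (fun p => coeff p r.natDegree) h0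
      simp only [coeff_sub, comp_C_mul_X_coeff, coeff_C_mul, coeff_zero, coeff_natDegree] at h
      have hl := leadingCoeff_ne_zero.2 hr
      refine hq1 (r.natDegree + 1) (by omega) (mul_left_cancel₀ hl ?_)
      field_simp at h
      linear_combination h
    · simp only [Int.ofNat_eq_natCast, gradedGen_natCast_add_one, gradedGen_natCast, thetaZ]
      rw [← mul_assoc, mul_aeval_of_skew (genA_mul_genC q)]
      simp only [map_sub, map_mul, aeval_C, ← Algebra.smul_def, zpow_neg_one]
      rw [mul_assoc, mul_assoc, ← pow_succ, ← pow_succ', sub_mul, smul_mul_assoc]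
  · refine ⟨C (q - 1)⁻¹ * (r.comp (C q * X) * (C q * X - 1) -
      C q⁻¹ * (r * (C (q⁻¹ ^ n) * X - 1))), fun hr h0 => ?_, ?_⟩
    · have h0 := (mul_eq_zero.1 h0).resolve_left (by simpa using hq)
      have h := congrArg (fun p => coeff p (r.natDegree + 1)) h0
      have hd : r.coeff (r.natDegree + 1) = 0 := coeff_eq_zero_of_natDegree_lt (by omega)
      have hl := leadingCoeff_ne_zero.2 hr
      have hmul (a : ℂ) (p : ℂ[X]) : p * (C a * X - 1) = C a * (p * X) - p := by ring
      simp only [hmul, coeff_sub, coeff_C_mul, coeff_mul_X, comp_C_mul_X_coeff, coeff_zero, coeff_natDegree,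
        hd] at h
      refine hq1 (r.natDegree + n + 2) (by omega) (mul_left_cancel₀ hl ?_)
      rw [inv_pow] at h
      field_simp at h
      linear_combination h
    · rw [gradedGen_negSucc_add_one, gradedGen_negSucc]
      have h1 : genA q * (aeval (genC q) r * genB q ^ (n + 1)) =
          aeval (genC q) (r.comp (C q * X)) * ((q - 1)⁻¹ • (q • genC q - 1)) * genB q ^ n := by
        rw [← mul_assoc, mul_aeval_of_skew (genA_mul_genC q), pow_succ', mul_assoc,
          ← mul_assoc (genA q), genA_mul_genB' hq, mul_assoc]
      have h2 : aeval (genC q) r * genB q ^ (n + 1) * genA q =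
          aeval (genC q) r * ((q - 1)⁻¹ • (q⁻¹ ^ n • genC q - 1)) * genB q ^ n := by
        rw [pow_succ, mul_assoc, mul_assoc (genB q ^ n), genB_mul_genA hq, mul_smul_comm,
          mul_sub, pow_mul_of_skew (genB_mul_genC hq0), mul_assoc, smul_mul_assoc _ (_ - _),
          sub_mul, mul_one, one_mul]
      rw [thetaZ, h1, h2]
      simp only [map_mul, map_sub, map_one, aeval_C, aeval_X, ← Algebra.smul_def, zpow_neg_one,
        mul_smul_comm, smul_mul_assoc, sub_mul]
      rw [smul_sub, smul_comm q⁻¹ (q - 1)⁻¹]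

lemma thetaZ_genC_pow_mul (K n : ℕ) (f : ℂ[X]) :
    thetaZ q n (genC q ^ K * aeval (genA q) f) =
      genC q ^ K * aeval (genA q) (C (q ^ K - q ^ n) * X * f) := by
  have hc : aeval (genA q) f * genA q = genA q * aeval (genA q) f := by
    simpa using congrArg (aeval (genA q)) (mul_comm f X)
  rw [thetaZ, ← mul_assoc, mul_pow_of_skew (genA_mul_genC q), zpow_natCast, mul_assoc _ _ (genA q),
    hc]
  simp only [map_mul, aeval_C, aeval_X, ← Algebra.smul_def, smul_mul_assoc, mul_smul_comm,
    mul_assoc]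
  exact (HAlg.sub_smul _ _ _).symm

lemma etaZ_genC_pow (hq0 : q ≠ 0) (K : ℕ) : etaZ q (-K) (genC q ^ K) = 0 := by
  rw [etaZ, mul_pow_of_skew (genB_mul_genC hq0), zpow_neg, zpow_natCast, inv_pow, sub_self]

lemma etaZ_genC_pow_mul_genA_pow_succ (hq0 : q ≠ 0) (hq : q - 1 ≠ 0) (K j : ℕ) :
    etaZ q (-K) (genC q ^ K * genA q ^ (j + 1)) =
      ((q ^ K)⁻¹ * (q - 1)⁻¹ * (1 - q ^ (j + 1))) • (genC q ^ (K + 1) * genA q ^ j) := by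
  have h1 : genB q * (genC q ^ K * genA q ^ (j + 1)) =
      (q ^ K)⁻¹ • (q - 1)⁻¹ • (genC q ^ (K + 1) * genA q ^ j - genC q ^ K * genA q ^ j) := by
    rw [← mul_assoc, mul_pow_of_skew (genB_mul_genC hq0), pow_succ' (genA q), smul_mul_assoc,
      mul_assoc, ← mul_assoc (genB q), genB_mul_genA hq, smul_mul_assoc, mul_smul_comm, sub_mul,
      one_mul, mul_sub, ← mul_assoc, ← pow_succ, inv_pow]
  have h2 : genC q ^ K * genA q ^ (j + 1) * genB q =
      (q - 1)⁻¹ • (q ^ (j + 1) • (genC q ^ (K + 1) * genA q ^ j) -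
        genC q ^ K * genA q ^ j) := by
    rw [pow_succ (genA q), mul_assoc, mul_assoc, genA_mul_genB' hq, mul_smul_comm, mul_sub,
      mul_one, mul_smul_comm q, pow_mul_of_skew (genA_mul_genC q), smul_mul_assoc, smul_smul,
      mul_smul_comm, mul_sub, mul_smul_comm, ← mul_assoc, ← pow_succ, ← pow_succ']
  rw [etaZ, h1, h2, zpow_neg, zpow_natCast]
  module

end DeformedCommutators

section Reachability

open Polynomial Relation

variable {q : ℂ}

/-- One application of a map from `Φ_ℤ`. -/
def PhiStep (q : ℂ) (x y : HAlg q) : Prop := ∃ f ∈ PhiZ q, f x = y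

lemma phiStep_thetaZ (n : ℤ) (x : HAlg q) : PhiStep q x (thetaZ q n x) := ⟨_, ⟨n, .inl rfl⟩, rfl⟩

lemma phiStep_etaZ (n : ℤ) (x : HAlg q) : PhiStep q x (etaZ q n x) := ⟨_, ⟨n, .inr rfl⟩, rfl⟩

lemma exists_list_of_reflTransGen {x y : HAlg q} (h : ReflTransGen (PhiStep q) x y) :
    ∃ L : List (HAlg q → HAlg q), (∀ f ∈ L, f ∈ PhiZ q) ∧ (L.foldr (· ∘ ·) id) x = y := by
  induction h with
  | refl => exact ⟨[], by simp, rfl⟩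
  | tail _ hstep ih =>
    obtain ⟨L, hL, rfl⟩ := ih
    obtain ⟨f, hf, rfl⟩ := hstep
    exact ⟨f :: L, by simpa [hf] using hL, rfl⟩

lemma reach_shift (hq0 : q ≠ 0) (hq1 : ∀ m : ℕ, 0 < m → q ^ m ≠ 1) (s : Finset ℤ)
    (p : ℤ → ℂ[X]) (d : ℕ) : ∃ p' : ℤ → ℂ[X], (∀ i, p i ≠ 0 → p' i ≠ 0) ∧
      ReflTransGen (PhiStep q) (∑ i ∈ s, aeval (genC q) (p i) * gradedGen q i)
        (∑ i ∈ s, aeval (genC q) (p' i) * gradedGen q (i + d)) := by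
  induction d with
  | zero => exact ⟨p, fun _ h => h, by simpa using ReflTransGen.refl⟩
  | succ d ih =>
    obtain ⟨p', hp', hr⟩ := ih
    choose T hT hT' using fun i => thetaZ_neg_one_gradedGen hq0 hq1 (i + d) (p' i)
    refine ⟨T, fun i hi => hT i (hp' i hi), ?_⟩
    convert hr.tail (phiStep_thetaZ (-1) _) using 1
    rw [thetaZ_sum]
    refine Finset.sum_congr rfl fun i _ => ?_
    rw [hT' i, Nat.cast_succ, add_assoc]

lemma reach_isolate (hq0 : q ≠ 0) (hq1 : ∀ m : ℕ, 0 < m → q ^ m ≠ 1) (K : ℕ) (t : Finset ℕ)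
    (hK : K ∉ t) (f : ℕ → ℂ[X]) (g : ℂ[X]) (hg : g ≠ 0) : ∃ g' : ℂ[X], g' ≠ 0 ∧
      ReflTransGen (PhiStep q)
        (genC q ^ K * aeval (genA q) g + ∑ k ∈ t, genC q ^ k * aeval (genA q) (f k))
        (genC q ^ K * aeval (genA q) g') := by
  induction t using Finset.induction_on generalizing f g with
  | empty => exact ⟨g, hg, by simpa using ReflTransGen.refl⟩
  | insert k t hk ih =>
    rw [Finset.mem_insert, not_or] at hK
    have hne : q ^ K - q ^ k ≠ 0 := sub_ne_zero.2 (pow_ne_pow_of_not_root hq0 hq1 hK.1)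
    obtain ⟨g', hg', hr⟩ := ih hK.2 (fun j => C (q ^ j - q ^ k) * X * f j)
      (C (q ^ K - q ^ k) * X * g) (mul_ne_zero (mul_ne_zero (C_ne_zero.2 hne) X_ne_zero) hg)
    refine ⟨g', hg', ReflTransGen.head ?_ hr⟩
    convert phiStep_thetaZ (k : ℤ) _ using 1
    rw [thetaZ_add, thetaZ_sum, Finset.sum_insert hk]
    simp only [thetaZ_genC_pow_mul]
    simp

lemma reach_genC_pow (hq0 : q ≠ 0) (hq1 : ∀ m : ℕ, 0 < m → q ^ m ≠ 1) (n K : ℕ) (c : ℕ → ℂ)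
    (hc : c n ≠ 0) : ∃ a : ℂ, a ≠ 0 ∧ ReflTransGen (PhiStep q)
      (∑ j ∈ Finset.range (n + 1), c j • (genC q ^ K * genA q ^ j)) (a • genC q ^ (K + n)) := by
  have hq : q - 1 ≠ 0 := sub_ne_zero.2 (by simpa using hq1 1 one_pos)
  induction n generalizing K c with
  | zero => exact ⟨c 0, hc, by simpa using ReflTransGen.refl⟩
  | succ n ih =>
    have hne : (1 : ℂ) - q ^ (n + 1) ≠ 0 := sub_ne_zero.2 (hq1 (n + 1) (by omega)).symm
    obtain ⟨a, ha, hr⟩ := ih (K + 1)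
      (fun j => c (j + 1) * ((q ^ K)⁻¹ * (q - 1)⁻¹ * (1 - q ^ (j + 1))))
      (mul_ne_zero hc (mul_ne_zero (mul_ne_zero (inv_ne_zero (pow_ne_zero K hq0))
        (inv_ne_zero hq)) hne))
    refine ⟨a, ha, ?_⟩
    rw [show K + (n + 1) = K + 1 + n by ring]
    refine ReflTransGen.head ?_ hr
    convert phiStep_etaZ (-(K : ℤ)) _ using 1
    rw [etaZ_sum, Finset.sum_range_succ' _ (n + 1)]
    simp only [etaZ_smul, etaZ_genC_pow_mul_genA_pow_succ hq0 hq, pow_zero, mul_one,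
      etaZ_genC_pow hq0, smul_zero, add_zero, smul_smul]

lemma reach_of_genC_pow_mul (hq0 : q ≠ 0) (hq1 : ∀ m : ℕ, 0 < m → q ^ m ≠ 1) (K : ℕ)
    (g : ℂ[X]) (hg : g ≠ 0) : ∃ (a : ℂ) (N : ℕ), a ≠ 0 ∧ 1 ≤ N ∧ ReflTransGen (PhiStep q)
      (genC q ^ K * aeval (genA q) g) (a • genC q ^ N) := by
  have hne : q ^ K - q ^ (K + 1) ≠ 0 :=
    sub_ne_zero.2 (pow_ne_pow_of_not_root hq0 hq1 (by omega))
  set G : ℂ[X] := C (q ^ K - q ^ (K + 1)) * X * g with hG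
  have hG0 : G ≠ 0 := mul_ne_zero (mul_ne_zero (C_ne_zero.2 hne) X_ne_zero) hg
  have hdeg : 1 ≤ G.natDegree := by
    rw [hG, natDegree_mul (mul_ne_zero (C_ne_zero.2 hne) X_ne_zero) hg, natDegree_C_mul_X _ hne]
    omega
  obtain ⟨a, ha, hr⟩ := reach_genC_pow hq0 hq1 G.natDegree K G.coeff
    (by simpa using hG0)
  refine ⟨a, K + G.natDegree, ha, by omega, ReflTransGen.head ?_ hr⟩
  convert phiStep_thetaZ ((K + 1 : ℕ) : ℤ) _ using 1
  rw [thetaZ_genC_pow_mul, ← hG, aeval_eq_sum_range, Finset.mul_sum]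
  simp only [mul_smul_comm]

/-- Regroup a sum of terms `r(C) A ^ e` by powers of `C`. -/
lemma sum_aeval_mul_genA_pow (s : Finset ℤ) (p : ℤ → ℂ[X]) (e : ℤ → ℕ) (M : ℕ)
    (hM : ∀ i ∈ s, (p i).natDegree < M) :
    ∑ i ∈ s, aeval (genC q) (p i) * genA q ^ e i = ∑ k ∈ Finset.range M,
      genC q ^ k * aeval (genA q) (∑ i ∈ s, C ((p i).coeff k) * X ^ e i) := by
  simp only [map_sum, Finset.mul_sum]
  rw [Finset.sum_comm]
  refine Finset.sum_congr rfl fun i hi => ?_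
  rw [aeval_eq_sum_range' (hM i hi), Finset.sum_mul]
  simp [← Algebra.smul_def]

lemma coeff_sum_C_mul_X_pow {s : Finset ℤ} {e : ℤ → ℕ} (he : Set.InjOn e s) (b : ℤ → ℂ) {i : ℤ}
    (hi : i ∈ s) : (∑ j ∈ s, C (b j) * X ^ e j).coeff (e i) = b i := by
  rw [finsetSum_coeff, Finset.sum_eq_single_of_mem i hi]
  · simp
  · intro j hj hji
    rw [coeff_C_mul_X_pow, if_neg fun h => hji (he hj hi h.symm)]

lemma exists_reach_genC_pow (hq0 : q ≠ 0) (hq1 : ∀ m : ℕ, 0 < m → q ^ m ≠ 1) {U : HAlg q}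
    (hU : U ≠ 0) : ∃ (a : ℂ) (N : ℕ), a ≠ 0 ∧ 1 ≤ N ∧
      ReflTransGen (PhiStep q) U (a • genC q ^ N) := by
  have hq : q - 1 ≠ 0 := sub_ne_zero.2 (by simpa using hq1 1 one_pos)
  obtain ⟨s, p, rfl⟩ := exists_eq_sum_gradedGen hq0 hq U
  obtain ⟨i, hi, hpi⟩ : ∃ i ∈ s, p i ≠ 0 := by
    by_contra! h
    exact hU (Finset.sum_eq_zero fun i hi => by rw [h i hi, map_zero, zero_mul])
  set d : ℕ := ∑ j ∈ s, j.natAbs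
  have hd : ∀ j ∈ s, 0 ≤ j + d := fun j hj => by
    have : j.natAbs ≤ d := Finset.single_le_sum (f := Int.natAbs) (fun _ _ => Nat.zero_le _) hj
    omega
  obtain ⟨p', hp', hr⟩ := reach_shift hq0 hq1 s p d
  set e : ℤ → ℕ := fun j => (j + d).toNat with he
  have hinj : Set.InjOn e s := fun j hj k hk h => by
    have := hd j hj
    have := hd k hk
    simp only [he] at h
    omega
  have hgen : ∀ j ∈ s, gradedGen q (j + d) = genA q ^ e j := fun j hj => by
    rw [← gradedGen_natCast, he, Int.toNat_of_nonneg (hd j hj)]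
  have hsum : ∑ j ∈ s, aeval (genC q) (p' j) * gradedGen q (j + d) =
      ∑ j ∈ s, aeval (genC q) (p' j) * genA q ^ e j :=
    Finset.sum_congr rfl fun j hj => by rw [hgen j hj]
  rw [hsum, sum_aeval_mul_genA_pow s p' e (∑ j ∈ s, (p' j).natDegree + 1) fun j hj =>
      Nat.lt_succ_of_le (Finset.single_le_sum (f := fun j => (p' j).natDegree)
        (fun _ _ => Nat.zero_le _) hj)] at hr
  set K := (p' i).natDegree
  have hK : K ∈ Finset.range (∑ j ∈ s, (p' j).natDegree + 1) :=
    Finset.mem_range.2 (Nat.lt_succ_of_le (Finset.single_le_sum (f := fun j => (p' j).natDegree)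
        (fun _ _ => Nat.zero_le _) hi))
  have hg : (∑ j ∈ s, C ((p' j).coeff K) * X ^ e j : ℂ[X]) ≠ 0 := fun h0 => by
    have h := coeff_sum_C_mul_X_pow hinj (fun j => (p' j).coeff K) hi
    rw [h0, coeff_zero] at h
    exact leadingCoeff_ne_zero.2 (hp' i hpi) h.symm
  rw [← Finset.add_sum_erase _ _ hK] at hr
  obtain ⟨g, hg0, hr'⟩ := reach_isolate hq0 hq1 K _ (Finset.notMem_erase K _)
    (fun k => ∑ j ∈ s, C ((p' j).coeff k) * X ^ e j) _ hg
  obtain ⟨a, N, ha, hN, hr''⟩ := reach_of_genC_pow_mul hq0 hq1 K g hg0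
  exact ⟨a, N, ha, hN, hr.trans (hr'.trans hr'')⟩

end Reachability

/-- For every nonzero `U ∈ H(q)` there exist a finite composition `ψ` of
maps from `Φ_ℤ`, a nonzero scalar `a ∈ ℂ`, and a positive integer `N` such that
`ψ(U) = a • C^N`. -/
theorem statement_8 (q : ℂ) (hq0 : q ≠ 0) (hq1 : ∀ m : ℕ, 0 < m → q ^ m ≠ 1)
    (U : HAlg q) (hU : U ≠ 0) :
    ∃ (L : List (HAlg q → HAlg q)) (a : ℂ) (N : ℕ),
      (∀ f ∈ L, f ∈ PhiZ q) ∧ a ≠ 0 ∧ 1 ≤ N ∧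
      (L.foldr (· ∘ ·) id) U = a • genC q ^ N := by
  obtain ⟨a, N, ha, hN, hr⟩ := exists_reach_genC_pow hq0 hq1 hU
  obtain ⟨L, hL, hLU⟩ := exists_list_of_reflTransGen hr
  exact ⟨L, a, N, hL, ha, hN, hLU⟩
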